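/- Let P be a length-n ROBP over alphabet [k] (k ≥ 2) of width w, and let Φ_t be the potential of layer t defined from the rectangle labeling of P. Then Φ_0 = 0, and for every 0 ≤ t ≤ n−1, Φ_{t+1} − Φ_t ≥ max{0, binom(t+k−1, k−1) − w}. -/

import Mathlib

open Finset

/-- A length-`n` read-once branching program over alphabet `σ` with outputs in `Out`.
Layer `t` has vertex set `Fin (size t)` (only layers `0, 1, …, n` are relevant);
layer `0` consists of a single start vertex, and each vertex of layer `t` has an
outgoing edge to layer `t+1` for every letter of the alphabet. -/
structure ROBP (σ Out : Type) (n : ℕ) where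
  size : ℕ → ℕ
  size0 : size 0 = 1
  sizePos : ∀ t, 0 < size t
  step : (t : ℕ) → Fin (size t) → σ → Fin (size (t + 1))
  out : Fin (size n) → Out

namespace ROBP

variable {σ Out : Type} {n : ℕ}

/-- The vertex reached in layer `t` on input `x` (only `x 0, …, x (t-1)` matter). -/
def state (P : ROBP σ Out n) (x : ℕ → σ) : (t : ℕ) → Fin (P.size t)
  | 0 => ⟨0, P.sizePos 0⟩
  | t + 1 => P.step t (state P x t) (x t)

/-- The width of an ROBP: the maximal number of vertices in a single layer. -/
def width (P : ROBP σ Out n) : ℕ := (Finset.range (n + 1)).sup P.size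

/-- Every vertex (in the relevant layers) is reached by some input: no useless vertices. -/
def Reachable (P : ROBP σ Out n) : Prop :=
  ∀ t, t ≤ n → ∀ v : Fin (P.size t), ∃ x : ℕ → σ, P.state x t = v

/-- The output of the program on input `x`. -/
def eval (P : ROBP σ Out n) (x : ℕ → σ) : Out := P.out (P.state x n)

end ROBP

/-- The number of occurrences of `j` among `x 0, …, x (t-1)`. -/
def countK {k : ℕ} (x : ℕ → Fin k) (t : ℕ) (j : Fin k) : ℕ :=
  ((Finset.range t).filter fun i => x i = j).card

/-- `P` computes `ApproxCount_k[n, Δ]`: on every input, each of the `k` outputs estimates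
the frequency of the corresponding letter within additive error `Δ`. -/
def ComputesApproxCountK (k n : ℕ) (Δ : ℝ) (P : ROBP (Fin k) (Fin k → ℝ) n) : Prop :=
  ∀ x : ℕ → Fin k, ∀ j : Fin k, |P.eval x j - (countK x n j : ℝ)| ≤ Δ

/-- `P` computes `ApproxCount[n, Δ]` (the `{0,1}` case). -/
def ComputesApproxCount (n : ℕ) (Δ : ℝ) (P : ROBP Bool ℝ n) : Prop :=
  ∀ x : ℕ → Bool, |P.eval x - (((Finset.range n).filter fun i => x i = true).card : ℝ)| ≤ Δ

/-- The number of `1`'s in coordinate `j` among `x 0, …, x (t-1)`. -/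
def countPar {k : ℕ} (x : ℕ → (Fin k → Bool)) (t : ℕ) (j : Fin k) : ℕ :=
  ((Finset.range t).filter fun i => x i j = true).card

/-- `P` computes `ApproxCount^par_k[n, Δ]`. -/
def ComputesApproxCountPar (k n : ℕ) (Δ : ℝ) (P : ROBP (Fin k → Bool) (Fin k → ℝ) n) : Prop :=
  ∀ x : ℕ → (Fin k → Bool), ∀ j : Fin k, |P.eval x j - (countPar x n j : ℝ)| ≤ Δ

/-- The inclusion `[k-1] ⊆ [k]`. -/
def idx {k : ℕ} (j : Fin (k - 1)) : Fin k := Fin.castLE (Nat.sub_le k 1) j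

/-- `a_j(v)`: the minimal possible number of `j`'s in the first `t` input words
reaching the vertex `v` of layer `t`. -/
noncomputable def rectLo {k n : ℕ} (P : ROBP (Fin k) (Fin k → ℝ) n) (t : ℕ)
    (v : Fin (P.size t)) (j : Fin (k - 1)) : ℕ :=
  sInf {c | ∃ x : ℕ → Fin k, P.state x t = v ∧ countK x t (idx j) = c}

/-- `b_j(v)`: the maximal possible number of `j`'s in the first `t` input words
reaching the vertex `v` of layer `t`. -/
noncomputable def rectHi {k n : ℕ} (P : ROBP (Fin k) (Fin k → ℝ) n) (t : ℕ)
    (v : Fin (P.size t)) (j : Fin (k - 1)) : ℕ :=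
  sSup {c | ∃ x : ℕ → Fin k, P.state x t = v ∧ countK x t (idx j) = c}

/-- `a_j(v)` for the `k`-parallel case. -/
noncomputable def parLo {k n : ℕ} (P : ROBP (Fin k → Bool) (Fin k → ℝ) n) (t : ℕ)
    (v : Fin (P.size t)) (j : Fin k) : ℕ :=
  sInf {c | ∃ x : ℕ → (Fin k → Bool), P.state x t = v ∧ countPar x t j = c}

/-- `b_j(v)` for the `k`-parallel case. -/
noncomputable def parHi {k n : ℕ} (P : ROBP (Fin k → Bool) (Fin k → ℝ) n) (t : ℕ)
    (v : Fin (P.size t)) (j : Fin k) : ℕ :=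
  sSup {c | ∃ x : ℕ → (Fin k → Bool), P.state x t = v ∧ countPar x t j = c}

/-- The axis-parallel box `[lo 1, hi 1] × ⋯ × [lo m, hi m]` (as a set of integer points). -/
def rect {m : ℕ} (lo hi : Fin m → ℕ) : Set (Fin m → ℕ) :=
  {y | ∀ j, lo j ≤ y j ∧ y j ≤ hi j}

/-- The potential `φ_t(x)` of the point `x` (k-counter case): the maximum, over all
rectangle labels of layer `t` containing `x`, of `min{Σ_j b_j, t} - Σ_j x_j`. -/
noncomputable def phiK {k n : ℕ} (P : ROBP (Fin k) (Fin k → ℝ) n) (t : ℕ)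
    (x : Fin (k - 1) → ℕ) : ℕ :=
  Finset.univ.sup fun v : Fin (P.size t) =>
    if ∀ j, rectLo P t v j ≤ x j ∧ x j ≤ rectHi P t v j then
      min (∑ j, rectHi P t v j) t - ∑ j, x j
    else 0

/-- `T_{t,k}`: tuples of naturals summing to at most `t`. -/
def Tset (k t : ℕ) : Finset (Fin (k - 1) → ℕ) :=
  (Fintype.piFinset fun _ => Finset.range (t + 1)).filter fun x => ∑ j, x j ≤ t

/-- The total potential `Φ_t` of layer `t` (k-counter case). -/
noncomputable def PhiK {k n : ℕ} (P : ROBP (Fin k) (Fin k → ℝ) n) (t : ℕ) : ℕ :=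
  ∑ x ∈ Tset k t, phiK P t x

/-- The potential `φ_t(x)` of the point `x` (k-parallel case). -/
noncomputable def phiPar {k n : ℕ} (P : ROBP (Fin k → Bool) (Fin k → ℝ) n) (t : ℕ)
    (x : Fin k → ℕ) : ℕ :=
  Finset.univ.sup fun v : Fin (P.size t) =>
    if ∀ j, parLo P t v j ≤ x j ∧ x j ≤ parHi P t v j then
      (∑ j, parHi P t v j) - ∑ j, x j
    else 0

/-- The total potential `Φ_t` of layer `t` (k-parallel case): the sum of `φ_t(x)`
over `x ∈ {0, 1, …, ⌊n/10⌋}^k`. -/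
noncomputable def PhiPar {k n : ℕ} (P : ROBP (Fin k → Bool) (Fin k → ℝ) n) (t : ℕ) : ℕ :=
  ∑ x ∈ Fintype.piFinset (fun _ : Fin k => Finset.range (n / 10 + 1)), phiPar P t x

/-- The generalized binomial coefficient `C(x, m) = x (x-1) ⋯ (x-m+1) / m!`. -/
noncomputable def genChoose (x : ℝ) (m : ℕ) : ℝ :=
  (∏ i ∈ Finset.range m, (x - (i : ℝ))) / (Nat.factorial m : ℝ)

theorem card_Tset {k : ℕ} (hk : 1 ≤ k) (t : ℕ) :
    (Tset k t).card = (t + k - 1).choose (k - 1) := by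
  have hmaps : ((Tset k t : Finset (Fin (k - 1) → ℕ)) : Set (Fin (k - 1) → ℕ)).MapsTo
      (fun x => ∑ j, x j) (Finset.range (t + 1)) := by
    intro x hx
    simp only [Tset, coe_filter, Set.mem_ofPred_eq] at hx
    simpa [Nat.lt_succ_iff] using hx.2
  rw [card_eq_sum_card_fiberwise hmaps, Nat.add_sub_assoc hk, ← Nat.sum_range_multichoose]
  refine Finset.sum_congr rfl fun i hi => ?_
  have hcard := Finset.card_finsuppAntidiag_nat_eq_multichoose
    (s := (Finset.univ : Finset (Fin (k - 1)))) i
  rw [Finset.card_univ, Fintype.card_fin] at hcard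
  rw [← hcard]
  refine Finset.card_equiv Finsupp.equivFunOnFinite.symm fun x => ?_
  simp only [Tset, mem_filter, Fintype.mem_piFinset, Finset.mem_range, mem_finsuppAntidiag,
    Finset.subset_univ, and_true, Finsupp.equivFunOnFinite_symm_apply_apply]
  have hi' : i < t + 1 := Finset.mem_range.mp hi
  constructor
  · exact fun h => h.2
  · intro h
    have hle : ∀ j, x j ≤ ∑ j, x j := fun j =>
      Finset.single_le_sum (f := x) (fun _ _ => Nat.zero_le _) (Finset.mem_univ j)
    refine ⟨⟨fun j => ?_, ?_⟩, h⟩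
    · have := hle j
      omega
    · omega

theorem Tset_subset_succ (k t : ℕ) : Tset k t ⊆ Tset k (t + 1) := by
  intro x hx
  simp only [Tset, mem_filter, Fintype.mem_piFinset, Finset.mem_range] at hx ⊢
  exact ⟨fun j => (hx.1 j).trans (Nat.lt_succ_self _), hx.2.trans (Nat.le_succ _)⟩

theorem countK_le {k : ℕ} (x : ℕ → Fin k) (t : ℕ) (j : Fin k) : countK x t j ≤ t :=
  (Finset.card_filter_le _ _).trans (Finset.card_range t).le

theorem countK_succ {k : ℕ} (x : ℕ → Fin k) (t : ℕ) (j : Fin k) :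
    countK x (t + 1) j = countK x t j + if x t = j then 1 else 0 := by
  unfold countK
  rw [Finset.range_add_one, Finset.filter_insert]
  split_ifs with h
  · rw [Finset.card_insert_of_notMem (by simp)]
  · rfl

theorem countK_congr {k : ℕ} {x y : ℕ → Fin k} {t : ℕ} (h : ∀ i < t, x i = y i) (j : Fin k) :
    countK x t j = countK y t j := by
  unfold countK
  congr 1
  exact Finset.filter_congr fun i hi => by rw [h i (Finset.mem_range.mp hi)]

namespace ROBP

theorem state_congr {σ Out : Type} {n : ℕ} (P : ROBP σ Out n) {x y : ℕ → σ} :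
    ∀ {t : ℕ}, (∀ i < t, x i = y i) → P.state x t = P.state y t
  | 0, _ => rfl
  | t + 1, h => by
    rw [state, state, P.state_congr fun i hi => h i (hi.trans (Nat.lt_succ_self t)),
      h t (Nat.lt_succ_self t)]

/-- Any prefix reaching `v` extends by the letter `c` to a prefix reaching `P.step t v c`. -/
theorem exists_extend {k n : ℕ} (P : ROBP (Fin k) (Fin k → ℝ) n) {t : ℕ} {x : ℕ → Fin k}
    {v : Fin (P.size t)} (hx : P.state x t = v) (c : Fin k) :
    ∃ y : ℕ → Fin k, P.state y (t + 1) = P.step t v c ∧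
      ∀ j, countK y (t + 1) j = countK x t j + if c = j then 1 else 0 := by
  have hagree : ∀ i < t, Function.update x t c i = x i := fun i hi =>
    Function.update_of_ne hi.ne _ _
  refine ⟨Function.update x t c, ?_, fun j => ?_⟩
  · rw [state, P.state_congr hagree, hx, Function.update_self]
  · rw [countK_succ, countK_congr hagree, Function.update_self]

end ROBP

section Rectangles

variable {k n : ℕ} (P : ROBP (Fin k) (Fin k → ℝ) n) {t : ℕ}

theorem rectLo_le {v : Fin (P.size t)} {x : ℕ → Fin k} (hx : P.state x t = v)
    (j : Fin (k - 1)) : rectLo P t v j ≤ countK x t (idx j) :=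
  Nat.sInf_le ⟨x, hx, rfl⟩

theorem le_rectHi {v : Fin (P.size t)} {x : ℕ → Fin k} (hx : P.state x t = v)
    (j : Fin (k - 1)) : countK x t (idx j) ≤ rectHi P t v j :=
  le_csSup ⟨t, by rintro _ ⟨y, -, rfl⟩; exact countK_le _ _ _⟩ ⟨x, hx, rfl⟩

variable {P}

theorem exists_countK_eq_rectLo (hreach : P.Reachable) (ht : t ≤ n) (v : Fin (P.size t))
    (j : Fin (k - 1)) :
    ∃ x : ℕ → Fin k, P.state x t = v ∧ countK x t (idx j) = rectLo P t v j :=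
  have ⟨x, hx⟩ := hreach t ht v
  Nat.sInf_mem (s := {c | ∃ x : ℕ → Fin k, P.state x t = v ∧ countK x t (idx j) = c})
    ⟨_, x, hx, rfl⟩

theorem exists_countK_eq_rectHi (hreach : P.Reachable) (ht : t ≤ n) (v : Fin (P.size t))
    (j : Fin (k - 1)) :
    ∃ x : ℕ → Fin k, P.state x t = v ∧ countK x t (idx j) = rectHi P t v j :=
  have ⟨x, hx⟩ := hreach t ht v
  Nat.sSup_mem (s := {c | ∃ x : ℕ → Fin k, P.state x t = v ∧ countK x t (idx j) = c})
    ⟨_, x, hx, rfl⟩ ⟨t, by rintro _ ⟨y, -, rfl⟩; exact countK_le _ _ _⟩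

theorem rectLo_step_le (hreach : P.Reachable) (ht : t ≤ n) (v : Fin (P.size t))
    (c : Fin k) (j : Fin (k - 1)) :
    rectLo P (t + 1) (P.step t v c) j ≤ rectLo P t v j + if c = idx j then 1 else 0 := by
  obtain ⟨x, hx, hcount⟩ := exists_countK_eq_rectLo hreach ht v j
  obtain ⟨y, hy, hcount'⟩ := P.exists_extend hx c
  rw [← hcount, ← hcount']
  exact rectLo_le P hy j

theorem le_rectHi_step (hreach : P.Reachable) (ht : t ≤ n) (v : Fin (P.size t))
    (c : Fin k) (j : Fin (k - 1)) :
    rectHi P t v j + (if c = idx j then 1 else 0) ≤ rectHi P (t + 1) (P.step t v c) j := by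
  obtain ⟨x, hx, hcount⟩ := exists_countK_eq_rectHi hreach ht v j
  obtain ⟨y, hy, hcount'⟩ := P.exists_extend hx c
  rw [← hcount, ← hcount']
  exact le_rectHi P hy j

end Rectangles

theorem idx_injective {k : ℕ} : Function.Injective (idx (k := k)) :=
  Fin.castLE_injective (Nat.sub_le k 1)

theorem exists_ne_idx {k : ℕ} (hk : 1 ≤ k) : ∃ c : Fin k, ∀ j : Fin (k - 1), c ≠ idx j := by
  refine ⟨⟨k - 1, by omega⟩, fun j h => ?_⟩
  have hval := congrArg Fin.val h
  have hj := j.isLt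
  simp only [idx, Fin.val_castLE] at hval
  omega

section Potential

variable {k n : ℕ} {P : ROBP (Fin k) (Fin k → ℝ) n} {t : ℕ}

theorem le_phiK {v : Fin (P.size t)} {x : Fin (k - 1) → ℕ}
    (hx : ∀ j, rectLo P t v j ≤ x j ∧ x j ≤ rectHi P t v j) :
    min (∑ j, rectHi P t v j) t - ∑ j, x j ≤ phiK P t x := by
  unfold phiK
  refine le_trans (le_of_eq ?_) (Finset.le_sup (Finset.mem_univ v))
  rw [if_pos hx]

/-- The rectangles of layer `t` cover `T_{t,k}`. -/
theorem exists_mem_rect (hk : 1 ≤ k) (hreach : P.Reachable) (ht : t ≤ n)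
    {x : Fin (k - 1) → ℕ} (hx : ∑ j, x j ≤ t) :
    ∃ v : Fin (P.size t), ∀ j, rectLo P t v j ≤ x j ∧ x j ≤ rectHi P t v j := by
  induction t generalizing x with
  | zero =>
    refine ⟨⟨0, P.sizePos 0⟩, fun j => ?_⟩
    have hxj : x j = 0 := by
      have := Finset.single_le_sum (f := x) (fun _ _ => Nat.zero_le _) (Finset.mem_univ j)
      omega
    obtain ⟨y, hy⟩ := hreach 0 ht ⟨0, P.sizePos 0⟩
    have hlo := rectLo_le P hy j
    have hcount := countK_le y 0 (idx j)
    omega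
  | succ t ih =>
    by_cases hsum : ∑ j, x j ≤ t
    · obtain ⟨v, hv⟩ := ih (by omega) hsum
      obtain ⟨c, hc⟩ := exists_ne_idx hk
      refine ⟨P.step t v c, fun j => ?_⟩
      have hlo := rectLo_step_le hreach (by omega : t ≤ n) v c j
      have hhi := le_rectHi_step hreach (by omega : t ≤ n) v c j
      have hvj := hv j
      rw [if_neg (hc j)] at hlo hhi
      omega
    · obtain ⟨i, -, hi⟩ : ∃ i ∈ Finset.univ, x i ≠ 0 :=
        Finset.exists_ne_zero_of_sum_ne_zero (by omega)
      have hdecomp : ∀ j, x j = Function.update x i (x i - 1) j + if i = j then 1 else 0 := by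
        intro j
        rcases eq_or_ne i j with rfl | hij
        · rw [Function.update_self, if_pos rfl]
          omega
        · rw [Function.update_of_ne hij.symm, if_neg hij, add_zero]
      have hsum' : ∑ j, x j = ∑ j, Function.update x i (x i - 1) j + 1 := by
        rw [Finset.sum_congr rfl fun j _ => hdecomp j, Finset.sum_add_distrib]
        simp
      obtain ⟨v, hv⟩ := ih (x := Function.update x i (x i - 1)) (by omega) (by omega)
      refine ⟨P.step t v (idx i), fun j => ?_⟩
      have hlo := rectLo_step_le hreach (by omega : t ≤ n) v (idx i) j
      have hhi := le_rectHi_step hreach (by omega : t ≤ n) v (idx i) j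
      have hvj := hv j
      have hxj := hdecomp j
      simp only [idx_injective.eq_iff] at hlo hhi
      omega

/-- The potential of a point of `T_{t,k}` is attained at a rectangle containing it. -/
theorem exists_phiK_eq (hk : 1 ≤ k) (hreach : P.Reachable) (ht : t ≤ n)
    {x : Fin (k - 1) → ℕ} (hx : ∑ j, x j ≤ t) :
    ∃ v : Fin (P.size t), (∀ j, rectLo P t v j ≤ x j ∧ x j ≤ rectHi P t v j) ∧
      phiK P t x = min (∑ j, rectHi P t v j) t - ∑ j, x j := by
  obtain ⟨u, hu⟩ := exists_mem_rect hk hreach ht hx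
  obtain ⟨v, -, hv⟩ := Finset.exists_mem_eq_sup (Finset.univ : Finset (Fin (P.size t)))
    ⟨u, Finset.mem_univ u⟩ fun v =>
      if ∀ j, rectLo P t v j ≤ x j ∧ x j ≤ rectHi P t v j then
        min (∑ j, rectHi P t v j) t - ∑ j, x j
      else 0
  by_cases hmem : ∀ j, rectLo P t v j ≤ x j ∧ x j ≤ rectHi P t v j
  · exact ⟨v, hmem, hv.trans (if_pos hmem)⟩
  · have hzero : phiK P t x = 0 := hv.trans (if_neg hmem)
    have hle := le_phiK hu
    exact ⟨u, hu, by omega⟩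

theorem phiK_le_succ (hk : 1 ≤ k) (hreach : P.Reachable) (ht : t ≤ n)
    {x : Fin (k - 1) → ℕ} (hx : ∑ j, x j ≤ t) : phiK P t x ≤ phiK P (t + 1) x := by
  obtain ⟨v, hmem, hv⟩ := exists_phiK_eq hk hreach ht hx
  obtain ⟨c, hc⟩ := exists_ne_idx hk
  have hlo := fun j => rectLo_step_le hreach ht v c j
  have hhi := fun j => le_rectHi_step hreach ht v c j
  simp only [hc, if_false, add_zero] at hlo hhi
  have hle := le_phiK (v := P.step t v c) (x := x) fun j =>
    ⟨(hlo j).trans (hmem j).1, (hmem j).2.trans (hhi j)⟩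
  have hsum := Finset.sum_le_sum fun j (_ : j ∈ Finset.univ) => hhi j
  omega

/-- The potential of `x` grows strictly unless `x` is the lower corner of the rectangle `v` at
which it is attained. -/
theorem phiK_lt_succ (hreach : P.Reachable) (ht : t ≤ n) {x : Fin (k - 1) → ℕ}
    (hx : ∑ j, x j ≤ t) {v : Fin (P.size t)}
    (hmem : ∀ j, rectLo P t v j ≤ x j ∧ x j ≤ rectHi P t v j)
    (hv : phiK P t x = min (∑ j, rectHi P t v j) t - ∑ j, x j) (hne : x ≠ rectLo P t v) :
    phiK P t x < phiK P (t + 1) x := by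
  obtain ⟨i, hi⟩ := Function.ne_iff.mp hne
  have hlo := fun j => rectLo_step_le hreach ht v (idx i) j
  have hhi := fun j => le_rectHi_step hreach ht v (idx i) j
  simp only [idx_injective.eq_iff] at hlo hhi
  have hle := le_phiK (v := P.step t v (idx i)) (x := x) fun j => by
    have hloj := hlo j
    have hhij := hhi j
    have hmemj := hmem j
    rcases eq_or_ne i j with rfl | hij
    · simp only [if_true] at hloj hhij
      omega
    · rw [if_neg hij] at hloj hhij
      omega
  have hsum := Finset.sum_le_sum fun j (_ : j ∈ Finset.univ) => hhi j
  simp only [Finset.sum_add_distrib, Finset.sum_ite_eq, Finset.mem_univ, if_true] at hsum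
  have hsumle := Finset.sum_le_sum fun j (_ : j ∈ Finset.univ) => (hmem j).2
  omega

/-- At most `P.size t` points of `T_{t,k}` keep their potential. -/
theorem card_phiK_eq_succ_le (hk : 1 ≤ k) (hreach : P.Reachable) (ht : t ≤ n) :
    ((Tset k t).filter fun x => phiK P (t + 1) x = phiK P t x).card ≤ P.size t := by
  have hsub : ((Tset k t).filter fun x => phiK P (t + 1) x = phiK P t x) ⊆
      Finset.univ.image (rectLo P t) := by
    intro x hx
    rw [mem_filter] at hx
    have hsum : ∑ j, x j ≤ t := (mem_filter.mp hx.1).2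
    obtain ⟨v, hmem, hv⟩ := exists_phiK_eq hk hreach ht hsum
    refine Finset.mem_image.mpr ⟨v, Finset.mem_univ v, ?_⟩
    by_contra hne
    exact (phiK_lt_succ hreach ht hsum hmem hv (Ne.symm hne)).ne' hx.2
  calc _ ≤ _ := Finset.card_le_card hsub
    _ ≤ _ := Finset.card_image_le
    _ = P.size t := Finset.card_fin _

theorem PhiK_add_card_le (hk : 1 ≤ k) (hreach : P.Reachable) (ht : t ≤ n) :
    PhiK P t + ((Tset k t).filter fun x => ¬ phiK P (t + 1) x = phiK P t x).card ≤
      PhiK P (t + 1) := by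
  unfold PhiK
  rw [Finset.card_filter, ← Finset.sum_add_distrib]
  refine (Finset.sum_le_sum fun x hx => ?_).trans
    (Finset.sum_le_sum_of_subset (Tset_subset_succ k t))
  have hle := phiK_le_succ hk hreach ht (mem_filter.mp hx).2
  split_ifs with h <;> omega

theorem PhiK_zero (P : ROBP (Fin k) (Fin k → ℝ) n) : PhiK P 0 = 0 := by
  simp [PhiK, phiK]

end Potential

/-- Growth of the potential, `k`-counter case:
`Φ_0 = 0` and `Φ_{t+1} - Φ_t ≥ max {0, binom(t+k-1, k-1) - w}` for `0 ≤ t ≤ n-1`,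
where `w` is the width of `P`. -/
theorem stmt3 (k n : ℕ) (hk : 2 ≤ k)
    (P : ROBP (Fin k) (Fin k → ℝ) n) (hreach : P.Reachable) :
    PhiK P 0 = 0 ∧
    ∀ t, t < n →
      (PhiK P (t + 1) : ℤ) - (PhiK P t : ℤ) ≥
        max 0 ((Nat.choose (t + k - 1) (k - 1) : ℤ) - (P.width : ℤ)) := by
  refine ⟨PhiK_zero P, fun t ht => ?_⟩
  have hk' : 1 ≤ k := by omega
  have hgrowth := PhiK_add_card_le hk' hreach ht.le
  have hcard := card_phiK_eq_succ_le hk' hreach ht.le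
  have hsplit := Finset.card_filter_add_card_filter_not (s := Tset k t)
    fun x => phiK P (t + 1) x = phiK P t x
  rw [card_Tset hk'] at hsplit
  have hwidth : P.size t ≤ P.width :=
    Finset.le_sup (f := P.size) (Finset.mem_range.mpr (by omega))
  refine max_le ?_ ?_ <;> omega
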